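/- arXiv:1203.3578 — 2 statements merged into one kernel-verified Lean document; each statement's English description precedes it below -/
import Mathlib

section
/- Let V be a finite set, E a nonempty finite set of undirected edges on V (parallel edges allowed), B ⊆ V, b : B → ℤ≥0, and let f be an integer-valued skew supermodular biset function on V. Let x be an extreme point of P(f,b,E) with 0 < x(e) < 1 for all e ∈ E. Then there exist a strongly laminar biset family L on V and a set C ⊆ B such that |L| + |C| = |E|, x(δ_E(Ŝ)) = f(Ŝ) ≥ 1 for all Ŝ ∈ L, x(δ_E(v)) = b(v) for all v ∈ C, and the incidence vectors in ℝ^E of the edge sets δ_E(Ŝ) for Ŝ ∈ L together with the incidence vectors of the edge sets δ_E(v) for v ∈ C are linearly independent. -/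
noncomputable section

attribute [local instance] Classical.propDecidable

/-- A biset on `V`: an ordered pair of finsets `inner ⊆ outer`. -/
structure Biset (V : Type*) where
  inner : Finset V
  outer : Finset V
  subset : inner ⊆ outer

namespace Biset

variable {V : Type*} [DecidableEq V]

instance [Fintype V] : Fintype (Biset V) :=
  Fintype.ofInjective (fun A => (A.inner, A.outer))
    (fun A B h => by
      cases A; cases B
      simp only [Prod.mk.injEq] at h
      cases h.1; cases h.2; rfl)

/-- The boundary `Γ(Ŝ) = S⁺ ∖ S`. -/
def boundary (A : Biset V) : Finset V := A.outer \ A.inner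

def inter (A B : Biset V) : Biset V :=
  ⟨A.inner ∩ B.inner, A.outer ∩ B.outer, Finset.inter_subset_inter A.subset B.subset⟩

def union (A B : Biset V) : Biset V :=
  ⟨A.inner ∪ B.inner, A.outer ∪ B.outer, Finset.union_subset_union A.subset B.subset⟩

def diff (A B : Biset V) : Biset V :=
  ⟨A.inner \ B.outer, A.outer \ B.inner, Finset.sdiff_subset_sdiff A.subset B.subset⟩

/-- Biset containment: `X̂ ⊆ Ŷ` iff `X ⊆ Y` and `X⁺ ⊆ Y⁺`. -/
def Sub (A B : Biset V) : Prop := A.inner ⊆ B.inner ∧ A.outer ⊆ B.outer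

def Laminar (L : Finset (Biset V)) : Prop :=
  ∀ A ∈ L, ∀ B ∈ L, Sub A B ∨ Sub B A ∨ A.inner ∩ B.inner = ∅

def StronglyLaminar (L : Finset (Biset V)) : Prop :=
  ∀ A ∈ L, ∀ B ∈ L, Sub A B ∨ Sub B A ∨
    (A.inner ∩ B.outer = ∅ ∧ B.inner ∩ A.outer = ∅)

def IntersectingSupermodular (f : Biset V → ℤ) : Prop :=
  ∀ A B : Biset V, (A.inner ∩ B.inner).Nonempty →
    f A + f B ≤ f (inter A B) + f (union A B)

def SkewSupermodular (f : Biset V → ℤ) : Prop :=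
  ∀ A B : Biset V,
    f A + f B ≤ f (inter A B) + f (union A B) ∨
    f A + f B ≤ f (diff A B) + f (diff B A)

def vertexBiset (v : V) : Biset V := ⟨{v}, {v}, Finset.Subset.refl _⟩

end Biset

/-- `γ = max { |Γ(Ŝ)| : f(Ŝ) > 0 }` (0 if no such biset exists). -/
def gammaOf {V : Type*} [Fintype V] [DecidableEq V] (f : Biset V → ℤ) : ℕ :=
  (Finset.univ.filter fun A : Biset V => 0 < f A).sup fun A => (Biset.boundary A).card

/-- The leaves (inclusion-minimal members) of a biset family. -/
def leaves {V : Type*} (L : Finset (Biset V)) : Finset (Biset V) :=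
  L.filter fun A => ∀ B ∈ L, Biset.Sub B A → B = A

/-- `max_{Ŝ ∈ L} |Γ(Ŝ)|` (0 if `L` is empty). -/
def gammaL {V : Type*} [DecidableEq V] (L : Finset (Biset V)) : ℕ :=
  L.sup fun A => (Biset.boundary A).card

section Undirected

variable {V E : Type*} [Fintype V] [DecidableEq V] [Fintype E]

/-- `δ_E(Ŝ)`: undirected edges covering the biset
(one end-node in the inner part, the other outside the outer part). -/
def uDelta (ep1 ep2 : E → V) (A : Biset V) : Finset E :=
  Finset.univ.filter fun e =>
    (ep1 e ∈ A.inner ∧ ep2 e ∉ A.outer) ∨ (ep2 e ∈ A.inner ∧ ep1 e ∉ A.outer)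

/-- `δ_E(v) = δ_E(({v},{v}))`. -/
def uDeg (ep1 ep2 : E → V) (v : V) : Finset E :=
  uDelta ep1 ep2 (Biset.vertexBiset v)

/-- The polytope `P(f,b,E)` for undirected edges. -/
def undirP (ep1 ep2 : E → V) (f : Biset V → ℤ) (B : Finset V) (b : V → ℕ) :
    Set (E → ℝ) :=
  {x | (∀ e : E, 0 ≤ x e ∧ x e ≤ 1) ∧
       (∀ A : Biset V, (f A : ℝ) ≤ ∑ e ∈ uDelta ep1 ep2 A, x e) ∧
       (∀ v ∈ B, ∑ e ∈ uDeg ep1 ep2 v, x e ≤ (b v : ℝ))}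

/-- Incidence vector of an edge set. -/
def incVec (F : Finset E) : E → ℝ := fun e => if e ∈ F then 1 else 0

end Undirected

namespace Biset

variable {V : Type*}

lemma Sub.refl (A : Biset V) : Sub A A := ⟨subset_rfl, subset_rfl⟩

lemma Sub.trans {A B C : Biset V} (h₁ : Sub A B) (h₂ : Sub B C) : Sub A C :=
  ⟨h₁.1.trans h₂.1, h₁.2.trans h₂.2⟩

variable [DecidableEq V]

/-- Two bisets are uncrossed if they are comparable or strongly disjoint. -/
def Uncrossed (A B : Biset V) : Prop :=
  Sub A B ∨ Sub B A ∨ (A.inner ∩ B.outer = ∅ ∧ B.inner ∩ A.outer = ∅)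

/-- The complementary biset `(V ∖ S⁺, V ∖ S)`. -/
def compl [Fintype V] (A : Biset V) : Biset V :=
  ⟨A.outerᶜ, A.innerᶜ, Finset.compl_subset_compl.2 A.subset⟩

lemma inter_sub_left (A B : Biset V) : Sub (inter A B) A :=
  ⟨Finset.inter_subset_left, Finset.inter_subset_left⟩

lemma inter_sub_right (A B : Biset V) : Sub (inter A B) B :=
  ⟨Finset.inter_subset_right, Finset.inter_subset_right⟩

lemma sub_inter {A B C : Biset V} (h₁ : Sub A B) (h₂ : Sub A C) : Sub A (inter B C) :=
  ⟨Finset.subset_inter h₁.1 h₂.1, Finset.subset_inter h₁.2 h₂.2⟩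

lemma sub_union_left (A B : Biset V) : Sub A (union A B) :=
  ⟨Finset.subset_union_left, Finset.subset_union_left⟩

lemma sub_union_right (A B : Biset V) : Sub B (union A B) :=
  ⟨Finset.subset_union_right, Finset.subset_union_right⟩

lemma union_sub {A B C : Biset V} (h₁ : Sub A C) (h₂ : Sub B C) : Sub (union A B) C :=
  ⟨Finset.union_subset h₁.1 h₂.1, Finset.union_subset h₁.2 h₂.2⟩

lemma Uncrossed.symm {A B : Biset V} (h : Uncrossed A B) : Uncrossed B A := by
  rw [Uncrossed] at *; tauto

variable [Fintype V]

lemma Sub.compl {A B : Biset V} (h : Sub A B) : Sub B.compl A.compl :=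
  ⟨Finset.compl_subset_compl.2 h.2, Finset.compl_subset_compl.2 h.1⟩

lemma Sub.compl_symm {A B : Biset V} (h : Sub A B.compl) : Sub B A.compl := by
  simpa [Biset.compl] using h.compl

lemma diff_eq_inter_compl (A B : Biset V) : diff A B = inter A B.compl := by
  simp [diff, inter, compl, Finset.sdiff_eq_inter_compl]

lemma sub_compl_iff {A B : Biset V} :
    Sub A B.compl ↔ A.inner ∩ B.outer = ∅ ∧ B.inner ∩ A.outer = ∅ := by
  rw [Sub, compl, Finset.subset_compl_iff_disjoint_right, Finset.subset_compl_iff_disjoint_right,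
    Finset.disjoint_iff_inter_eq_empty, Finset.disjoint_iff_inter_eq_empty,
    Finset.inter_comm A.outer]

lemma uncrossed_iff {A B : Biset V} :
    Uncrossed A B ↔ Sub A B ∨ Sub B A ∨ Sub A B.compl := by
  rw [Uncrossed, sub_compl_iff]

lemma Uncrossed.inter {X Y Z : Biset V} (hX : Uncrossed X Z) (hY : Uncrossed Y Z) :
    Uncrossed (inter X Y) Z := by
  rw [uncrossed_iff] at *
  have hl := inter_sub_left X Y
  have hr := inter_sub_right X Y
  rcases hX with h | h | h
  · exact .inl (hl.trans h)
  · rcases hY with h' | h' | h'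
    · exact .inl (hr.trans h')
    · exact .inr (.inl (sub_inter h h'))
    · exact .inr (.inr (hr.trans h'))
  · exact .inr (.inr (hl.trans h))

lemma Uncrossed.union {X Y Z : Biset V} (hXY : ¬ Uncrossed X Y)
    (hX : Uncrossed X Z) (hY : Uncrossed Y Z) : Uncrossed (union X Y) Z := by
  rw [uncrossed_iff] at *
  rcases hX with h | h | h <;> rcases hY with h' | h' | h'
  · exact .inl (union_sub h h')
  · exact .inr (.inl (h'.trans (sub_union_right _ _)))
  · exact absurd (.inr (.inr (h.trans h'.compl_symm))) hXY
  · exact .inr (.inl (h.trans (sub_union_left _ _)))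
  · exact .inr (.inl (h.trans (sub_union_left _ _)))
  · exact .inr (.inl (h.trans (sub_union_left _ _)))
  · exact absurd (.inr (.inr (h'.trans h.compl_symm).compl_symm)) hXY
  · exact .inr (.inl (h'.trans (sub_union_right _ _)))
  · exact .inr (.inr (union_sub h h'))

lemma Uncrossed.diff {X Y Z : Biset V} (hXY : ¬ Uncrossed X Y)
    (hX : Uncrossed X Z) (hY : Uncrossed Y Z) : Uncrossed (diff X Y) Z := by
  rw [diff_eq_inter_compl]
  rw [uncrossed_iff] at *
  have hl := inter_sub_left X Y.compl
  have hr := inter_sub_right X Y.compl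
  rcases hX with h | h | h
  · exact .inl (hl.trans h)
  · rcases hY with h' | h' | h'
    · exact absurd (.inr (.inl (h'.trans h))) hXY
    · exact .inr (.inr (hr.trans h'.compl))
    · exact .inr (.inl (sub_inter h h'.compl_symm))
  · exact .inr (.inr (hl.trans h))

end Biset

section Tight

variable {V E : Type*} [DecidableEq V] [Fintype E]

lemma sum_mul_incVec (x : E → ℝ) (F : Finset E) :
    ∑ e, x e * incVec F e = ∑ e ∈ F, x e := by
  simp [incVec, Finset.sum_ite_mem]

lemma incVec_inter_add_union_le (ep1 ep2 : E → V) (A B : Biset V) (e : E) :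
    incVec (uDelta ep1 ep2 (A.inter B)) e + incVec (uDelta ep1 ep2 (A.union B)) e ≤
      incVec (uDelta ep1 ep2 A) e + incVec (uDelta ep1 ep2 B) e := by
  have hA₁ := @A.subset (ep1 e)
  have hA₂ := @A.subset (ep2 e)
  have hB₁ := @B.subset (ep1 e)
  have hB₂ := @B.subset (ep2 e)
  simp only [incVec, uDelta, Biset.inter, Biset.union, Finset.mem_filter, Finset.mem_univ,
    true_and, Finset.mem_inter, Finset.mem_union]
  split_ifs <;> first | (norm_num; done) | (exfalso; grind)

lemma incVec_diff_add_diff_le (ep1 ep2 : E → V) (A B : Biset V) (e : E) :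
    incVec (uDelta ep1 ep2 (A.diff B)) e + incVec (uDelta ep1 ep2 (B.diff A)) e ≤
      incVec (uDelta ep1 ep2 A) e + incVec (uDelta ep1 ep2 B) e := by
  have hA₁ := @A.subset (ep1 e)
  have hA₂ := @A.subset (ep2 e)
  have hB₁ := @B.subset (ep1 e)
  have hB₂ := @B.subset (ep2 e)
  simp only [incVec, uDelta, Biset.diff, Finset.mem_filter, Finset.mem_univ,
    true_and, Finset.mem_sdiff]
  split_ifs <;> first | (norm_num; done) | (exfalso; grind)

/-- A biset is tight for `x` if its covering constraint holds with equality. -/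
def IsTight (ep1 ep2 : E → V) (f : Biset V → ℤ) (x : E → ℝ) (A : Biset V) : Prop :=
  ∑ e ∈ uDelta ep1 ep2 A, x e = (f A : ℝ)

variable {ep1 ep2 : E → V} {f : Biset V → ℤ} {x : E → ℝ}

lemma IsTight.exchange {A B C D : Biset V} (hpos : ∀ e, 0 < x e)
    (hcov : ∀ S : Biset V, (f S : ℝ) ≤ ∑ e ∈ uDelta ep1 ep2 S, x e)
    (hA : IsTight ep1 ep2 f x A) (hB : IsTight ep1 ep2 f x B)
    (hle : ∀ e, incVec (uDelta ep1 ep2 C) e + incVec (uDelta ep1 ep2 D) e ≤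
      incVec (uDelta ep1 ep2 A) e + incVec (uDelta ep1 ep2 B) e)
    (hf : f A + f B ≤ f C + f D) :
    IsTight ep1 ep2 f x C ∧ IsTight ep1 ep2 f x D ∧
      incVec (uDelta ep1 ep2 A) + incVec (uDelta ep1 ep2 B) =
        incVec (uDelta ep1 ep2 C) + incVec (uDelta ep1 ep2 D) := by
  have hf' : (f A : ℝ) + f B ≤ f C + f D := by exact_mod_cast hf
  have hC := hcov C
  have hD := hcov D
  unfold IsTight at *
  have hnn : ∀ e ∈ Finset.univ, 0 ≤ x e * ((incVec (uDelta ep1 ep2 A) e +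
      incVec (uDelta ep1 ep2 B) e) - (incVec (uDelta ep1 ep2 C) e +
      incVec (uDelta ep1 ep2 D) e)) :=
    fun e _ => mul_nonneg (hpos e).le (sub_nonneg.2 (hle e))
  have hsum : ∑ e, x e * ((incVec (uDelta ep1 ep2 A) e +
      incVec (uDelta ep1 ep2 B) e) - (incVec (uDelta ep1 ep2 C) e +
      incVec (uDelta ep1 ep2 D) e)) = (f A + f B) -
      (∑ e ∈ uDelta ep1 ep2 C, x e + ∑ e ∈ uDelta ep1 ep2 D, x e) := by
    simp only [mul_sub, mul_add, Finset.sum_sub_distrib, Finset.sum_add_distrib, sum_mul_incVec,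
      hA, hB]
  have h0 := Finset.sum_nonneg hnn
  refine ⟨by linarith, by linarith, ?_⟩
  have hz := (Finset.sum_eq_zero_iff_of_nonneg hnn).1 (by linarith)
  funext e
  have := (mul_eq_zero.1 (hz e (Finset.mem_univ e))).resolve_left (hpos e).ne'
  simpa using sub_eq_zero.1 this

lemma IsTight.one_le_of_ne_zero {A : Biset V} (hpos : ∀ e, 0 < x e)
    (hA : IsTight ep1 ep2 f x A) (h : incVec (uDelta ep1 ep2 A) ≠ 0) : 1 ≤ f A := by
  have hne : (uDelta ep1 ep2 A).Nonempty := by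
    by_contra hc
    rw [Finset.not_nonempty_iff_eq_empty] at hc
    exact h (by funext e; simp [incVec, hc])
  have := Finset.sum_pos (fun e (_ : e ∈ uDelta ep1 ep2 A) => hpos e) hne
  rw [hA] at this
  have : 0 < f A := by exact_mod_cast this
  omega

/-- If a subspace contains the vectors of a strongly laminar tight family `L`, and of all tight
bisets crossing no member of `L`, then it contains the vectors of all tight bisets. -/
lemma IsTight.incVec_mem [Fintype V] (hf : Biset.SkewSupermodular f) (hpos : ∀ e, 0 < x e)
    (hcov : ∀ S : Biset V, (f S : ℝ) ≤ ∑ e ∈ uDelta ep1 ep2 S, x e)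
    {L : Finset (Biset V)} (hL : Biset.StronglyLaminar L)
    (hLt : ∀ A ∈ L, IsTight ep1 ep2 f x A) (S : Submodule ℝ (E → ℝ))
    (hLS : ∀ A ∈ L, incVec (uDelta ep1 ep2 A) ∈ S)
    (hS : ∀ X, IsTight ep1 ep2 f x X → (∀ Z ∈ L, X.Uncrossed Z) →
      incVec (uDelta ep1 ep2 X) ∈ S)
    {X : Biset V} (hX : IsTight ep1 ep2 f x X) : incVec (uDelta ep1 ep2 X) ∈ S := by
  induction hn : (L.filter fun Z => ¬ X.Uncrossed Z).card using Nat.strong_induction_on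
    generalizing X with
  | _ n ih =>
    subst hn
    by_cases hc : ∀ Z ∈ L, X.Uncrossed Z
    · exact hS X hX hc
    push Not at hc
    obtain ⟨Y, hY, hXY⟩ := hc
    have hYX : ¬ Y.Uncrossed X := fun h => hXY h.symm
    have step : ∀ W, IsTight ep1 ep2 f x W → W.Uncrossed Y →
        (∀ Z ∈ L, X.Uncrossed Z → W.Uncrossed Z) → incVec (uDelta ep1 ep2 W) ∈ S := by
      intro W hW hWY hWZ
      refine ih _ (Finset.card_lt_card ?_) hW rfl
      rw [Finset.ssubset_iff_of_subset]
      · exact ⟨Y, by simp [hY, hXY], by simp [hWY]⟩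
      · intro Z hZ
        rw [Finset.mem_filter] at hZ ⊢
        exact ⟨hZ.1, fun h => hZ.2 (hWZ Z hZ.1 h)⟩
    have key : ∀ W W', incVec (uDelta ep1 ep2 W) ∈ S → incVec (uDelta ep1 ep2 W') ∈ S →
        incVec (uDelta ep1 ep2 X) + incVec (uDelta ep1 ep2 Y) =
          incVec (uDelta ep1 ep2 W) + incVec (uDelta ep1 ep2 W') →
        incVec (uDelta ep1 ep2 X) ∈ S := by
      intro W W' hW hW' he
      rw [eq_sub_of_add_eq he]
      exact S.sub_mem (S.add_mem hW hW') (hLS Y hY)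
    rcases hf X Y with h | h
    · obtain ⟨h1, h2, h3⟩ := hX.exchange hpos hcov (hLt Y hY)
        (incVec_inter_add_union_le ep1 ep2 X Y) h
      refine key _ _ (step _ h1 ?_ ?_) (step _ h2 ?_ ?_) h3
      · exact .inl (Biset.inter_sub_right X Y)
      · exact fun Z hZ hXZ => hXZ.inter (hL Y hY Z hZ)
      · exact .inr (.inl (Biset.sub_union_right X Y))
      · exact fun Z hZ hXZ => hXZ.union hXY (hL Y hY Z hZ)
    · obtain ⟨h1, h2, h3⟩ := hX.exchange hpos hcov (hLt Y hY)
        (incVec_diff_add_diff_le ep1 ep2 X Y) h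
      refine key _ _ (step _ h1 ?_ ?_) (step _ h2 ?_ ?_) h3
      · rw [Biset.uncrossed_iff, Biset.diff_eq_inter_compl]
        exact .inr (.inr (Biset.inter_sub_right X Y.compl))
      · exact fun Z hZ hXZ => hXZ.diff hXY (hL Y hY Z hZ)
      · rw [Biset.uncrossed_iff, Biset.diff_eq_inter_compl]
        exact .inl (Biset.inter_sub_left Y X.compl)
      · exact fun Z hZ hXZ => Biset.Uncrossed.diff hYX (hL Y hY Z hZ) hXZ

/-- At an extreme point with no tight box constraint, the tight constraints span `ℝ^E`. -/
lemma eq_top_of_mem_extremePoints [Fintype V] {B : Finset V} {b : V → ℕ}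
    (hx : x ∈ Set.extremePoints ℝ (undirP ep1 ep2 f B b))
    (hx01 : ∀ e : E, 0 < x e ∧ x e < 1) (S : Submodule ℝ (E → ℝ))
    (hS : ∀ A, IsTight ep1 ep2 f x A → incVec (uDelta ep1 ep2 A) ∈ S)
    (hSv : ∀ v ∈ B, ∑ e ∈ uDeg ep1 ep2 v, x e = (b v : ℝ) → incVec (uDeg ep1 ep2 v) ∈ S) :
    S = ⊤ := by
  by_contra hne
  obtain ⟨φ, hφ, hker⟩ := Submodule.exists_le_ker_of_lt_top S (lt_top_iff_ne_top.2 hne)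
  set y : E → ℝ := fun e => φ (Pi.single e 1) with hy
  have hφy : ∀ F : Finset E, φ (incVec F) = ∑ e ∈ F, y e := by
    intro F
    rw [LinearMap.pi_apply_eq_sum_univ φ, ← sum_mul_incVec y]
    refine Finset.sum_congr rfl fun e _ => ?_
    rw [smul_eq_mul, mul_comm, hy]
    congr 2
    funext j
    simp [Pi.single_apply, eq_comm]
  have hy0 : y ≠ 0 := by
    intro h
    apply hφ
    refine LinearMap.pi_ext' fun e => LinearMap.ext_ring ?_
    simpa using congrFun h e
  obtain ⟨hxP, hext⟩ := mem_extremePoints.1 hx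
  have hcont : ∀ F : Finset E, Continuous fun t : ℝ => ∑ e ∈ F, (x + t • y) e := by
    intro F
    simp only [Pi.add_apply, Pi.smul_apply]
    fun_prop
  have htight : ∀ F : Finset E, incVec F ∈ S → ∀ t : ℝ,
      ∑ e ∈ F, (x + t • y) e = ∑ e ∈ F, x e := by
    intro F hF t
    have : ∑ e ∈ F, y e = 0 := by rw [← hφy]; exact hker hF
    simp [Finset.sum_add_distrib, ← Finset.mul_sum, this]
  have hev : ∀ᶠ t in nhds (0 : ℝ), x + t • y ∈ undirP ep1 ep2 f B b := by
    refine Filter.Eventually.and ?_ (Filter.Eventually.and ?_ ?_)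
    · refine Filter.eventually_all.2 fun e => ?_
      have hc : Continuous fun t : ℝ => (x + t • y) e := by
        simpa using hcont {e}
      have h0 := (hc.tendsto 0).eventually_const_lt (u := 0) (by simpa using (hx01 e).1)
      have h1 := (hc.tendsto 0).eventually_lt_const (u := 1) (by simpa using (hx01 e).2)
      filter_upwards [h0, h1] with t ht0 ht1 using ⟨ht0.le, ht1.le⟩
    · refine Filter.eventually_all.2 fun A => ?_
      rcases (hxP.2.1 A).eq_or_lt with h | h
      · exact .of_forall fun t => by rw [htight _ (hS A h.symm)]; exact h.le
      · have := ((hcont (uDelta ep1 ep2 A)).tendsto 0).eventually_const_lt (u := (f A : ℝ))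
          (by simpa using h)
        filter_upwards [this] with t ht using ht.le
    · refine Filter.eventually_all.2 fun v => Filter.eventually_all.2 fun hv => ?_
      rcases (hxP.2.2 v hv).eq_or_lt with h | h
      · exact .of_forall fun t => by rw [htight _ (hSv v hv h)]; exact h.le
      · have := ((hcont (uDeg ep1 ep2 v)).tendsto 0).eventually_lt_const (u := (b v : ℝ))
          (by simpa using h)
        filter_upwards [this] with t ht using ht.le
  obtain ⟨ε, hε, hball⟩ := Metric.eventually_nhds_iff.1 hev
  have hp := hball (y := ε / 2) (by simp [abs_of_pos hε, hε])
  have hm := hball (y := -(ε / 2)) (by simp [abs_of_pos hε, hε])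
  have hseg : x ∈ openSegment ℝ (x + (ε / 2) • y) (x + (-(ε / 2)) • y) :=
    ⟨1 / 2, 1 / 2, by norm_num, by norm_num, by norm_num, by module⟩
  have h := (hext _ hp _ hm hseg).1
  rw [add_eq_left, smul_eq_zero] at h
  exact h.elim (by positivity) hy0

end Tight

theorem stmt_4 {V E : Type*} [Fintype V] [DecidableEq V] [Fintype E] [Nonempty E]
    (ep1 ep2 : E → V) (B : Finset V) (b : V → ℕ)
    (f : Biset V → ℤ) (hf : Biset.SkewSupermodular f)
    (x : E → ℝ) (hx : x ∈ Set.extremePoints ℝ (undirP ep1 ep2 f B b))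
    (hx01 : ∀ e : E, 0 < x e ∧ x e < 1) :
    ∃ (L : Finset (Biset V)) (C : Finset V),
      Biset.StronglyLaminar L ∧ C ⊆ B ∧ L.card + C.card = Fintype.card E ∧
      (∀ A ∈ L, (∑ e ∈ uDelta ep1 ep2 A, x e) = (f A : ℝ) ∧ 1 ≤ f A) ∧
      (∀ v ∈ C, (∑ e ∈ uDeg ep1 ep2 v, x e) = (b v : ℝ)) ∧
      LinearIndependent ℝ (Sum.elim
        (fun A : {A // A ∈ L} => incVec (uDelta ep1 ep2 A.1))
        (fun v : {v // v ∈ C} => incVec (uDeg ep1 ep2 v.1))) := by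
  have hpos : ∀ e, 0 < x e := fun e => (hx01 e).1
  have hcov := hx.1.2.1
  let g : Biset V ⊕ V → E → ℝ :=
    Sum.elim (fun A => incVec (uDelta ep1 ep2 A)) (fun v => incVec (uDeg ep1 ep2 v))
  let Good : Finset (Biset V ⊕ V) → Prop := fun T =>
    Biset.StronglyLaminar T.toLeft ∧ (∀ A ∈ T.toLeft, IsTight ep1 ep2 f x A) ∧
    (∀ v ∈ T.toRight, v ∈ B ∧ ∑ e ∈ uDeg ep1 ep2 v, x e = (b v : ℝ)) ∧
    LinearIndepOn ℝ g (T : Set (Biset V ⊕ V))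
  obtain ⟨T, hT, hmax⟩ := Finset.exists_max_image (Finset.univ.filter Good) Finset.card
    ⟨∅, by simp [Good, Biset.StronglyLaminar]⟩
  obtain ⟨hlam, htight, hvert, hind⟩ := (Finset.mem_filter.1 hT).2
  set S := Submodule.span ℝ (g '' (T : Set (Biset V ⊕ V))) with hS
  have hmem : ∀ a ∈ T, g a ∈ S := fun a ha => Submodule.subset_span ⟨a, ha, rfl⟩
  have hins : ∀ a, Good (insert a T) → a ∈ T := by
    intro a ha
    by_contra hn
    have := hmax (insert a T) (Finset.mem_filter.2 ⟨Finset.mem_univ _, ha⟩)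
    rw [Finset.card_insert_of_notMem hn] at this
    omega
  have hindep : ∀ a, g a ∉ S → LinearIndepOn ℝ g (insert a T : Finset (Biset V ⊕ V)) := by
    intro a ha
    rw [Finset.coe_insert]
    exact hind.insert ha
  have htop : S = ⊤ := by
    refine eq_top_of_mem_extremePoints hx hx01 S (fun A hA => ?_) (fun v hv hvb => ?_)
    · refine hA.incVec_mem hf hpos hcov hlam htight S
        (fun Y hY => hmem (.inl Y) (Finset.mem_toLeft.1 hY)) (fun X hX hXL => ?_)
      by_contra hn
      refine hn (hmem (.inl X) (hins _ ⟨?_, ?_, ?_, hindep (.inl X) hn⟩))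
      · intro Y hY Z hZ
        rw [Finset.toLeft_insert_inl, Finset.mem_insert] at hY hZ
        rcases hY with rfl | hY <;> rcases hZ with rfl | hZ
        · exact .inl (.refl _)
        · exact hXL Z hZ
        · exact (hXL Y hY).symm
        · exact hlam Y hY Z hZ
      · simpa using ⟨hX, by simpa using htight⟩
      · simpa using hvert
    · by_contra hn
      refine hn (hmem (.inr v) (hins _ ⟨?_, ?_, ?_, hindep (.inr v) hn⟩))
      · simpa using hlam
      · simpa using htight
      · simpa using ⟨⟨hv, hvb⟩, by simpa using hvert⟩
  refine ⟨T.toLeft, T.toRight, hlam, fun v hv => (hvert v hv).1, ?_, fun A hA =>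
    ⟨htight A hA, (htight A hA).one_le_of_ne_zero hpos ?_⟩, fun v hv => (hvert v hv).2, ?_⟩
  · rw [Finset.card_toLeft_add_card_toRight, ← Module.finrank_fintype_fun_eq_card ℝ (η := E),
      ← finrank_top, ← htop, hS, Set.image_eq_range]
    simpa using (finrank_span_eq_card (b := fun a : (T : Set (Biset V ⊕ V)) => g a) hind).symm
  · exact hind.ne_zero (i := .inl A) (Finset.mem_toLeft.1 hA)
  · let ι : {A // A ∈ T.toLeft} ⊕ {v // v ∈ T.toRight} → (T : Set (Biset V ⊕ V)) :=
      Sum.elim (fun A => ⟨.inl A.1, Finset.mem_toLeft.1 A.2⟩)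
        (fun v => ⟨.inr v.1, Finset.mem_toRight.1 v.2⟩)
    have hι : Function.Injective ι := by
      rintro (⟨a, ha⟩ | ⟨a, ha⟩) (⟨c, hc⟩ | ⟨c, hc⟩) h <;> simp_all [ι]
    convert LinearIndependent.comp hind ι hι using 1
    funext a
    rcases a with a | a <;> rfl
end
end

section
/- Let V be a finite set, E a nonempty finite set of directed edges on V, B ⊆ V, b : B → ℤ≥0, f an integer-valued biset function on V, and α ≥ 2 an integer. Let x ∈ P(f,b,E) with 0 < x(e) < 1 for all e ∈ E, and suppose there exist a laminar biset family L on V and C ⊆ B such that |L| + |C| = |E|, x(δ⁻_E(Ŝ)) = f(Ŝ) ≥ 1 for all Ŝ ∈ L, x(δ⁺_E(v)) = b(v) for all v ∈ C, and the incidence vectors in ℝ^E of the sets δ⁻_E(Ŝ) for Ŝ ∈ L together with those of δ⁺_E(v) for v ∈ C are linearly independent. Let 𝓔 be the set of leaves of L and γ = max_{Ŝ∈L} |Γ(Ŝ)| (γ = 0 if L is empty). If |C| > (α−1)|𝓔|, then there is an edge e ∈ E with x(e) ≥ 1/α, or there is a node v ∈ C with |δ⁺_E(v)| ≤ α·b(v)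 + ⌈2γ/(α−1)⌉ + 1. -/
noncomputable section

attribute [local instance] Classical.propDecidable

section Directed

variable {V E : Type*} [Fintype V] [DecidableEq V] [Fintype E]

/-- `δ⁻_E(Ŝ)`: edges entering the biset (tail outside outer part, head in inner part). -/
def inDelta (tail head : E → V) (A : Biset V) : Finset E :=
  Finset.univ.filter fun e => head e ∈ A.inner ∧ tail e ∉ A.outer

/-- `δ⁺_E(Ŝ)`: edges leaving the biset. -/
def outDelta (tail head : E → V) (A : Biset V) : Finset E :=
  Finset.univ.filter fun e => tail e ∈ A.inner ∧ head e ∉ A.outer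

/-- `δ⁺_E(v)`. -/
def outDeg (tail head : E → V) (v : V) : Finset E :=
  outDelta tail head (Biset.vertexBiset v)

/-- The polytope `P(f,b,E)` for directed edges. -/
def dirP (tail head : E → V) (f : Biset V → ℤ) (B : Finset V) (b : V → ℕ) :
    Set (E → ℝ) :=
  {x | (∀ e : E, 0 ≤ x e ∧ x e ≤ 1) ∧
       (∀ A : Biset V, (f A : ℝ) ≤ ∑ e ∈ inDelta tail head A, x e) ∧
       (∀ v ∈ B, ∑ e ∈ outDeg tail head v, x e ≤ (b v : ℝ))}

end Directed

namespace Biset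

variable {V : Type*}

instance : PartialOrder (Biset V) where
  le := Sub
  le_refl A := ⟨subset_rfl, subset_rfl⟩
  le_trans _ _ _ h h' := ⟨h.1.trans h'.1, h.2.trans h'.2⟩
  le_antisymm A B h h' := by
    cases A; cases B
    cases Finset.Subset.antisymm h.1 h'.1
    cases Finset.Subset.antisymm h.2 h'.2
    rfl

/-- The maximal proper subsets of `A` in the family `L`. -/
def children (L : Finset (Biset V)) (A : Biset V) : Finset (Biset V) :=
  L.filter fun R => R < A ∧ ∀ B ∈ L, R < B → ¬ B < A

/-- The maximal members of `L`. -/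
def roots (L : Finset (Biset V)) : Finset (Biset V) :=
  L.filter fun A => ∀ B ∈ L, ¬ A < B

lemma mem_children {L : Finset (Biset V)} {A R : Biset V} :
    R ∈ children L A ↔ R ∈ L ∧ R < A ∧ ∀ B ∈ L, R < B → ¬ B < A := by
  simp [children]

lemma mem_roots {L : Finset (Biset V)} {A : Biset V} :
    A ∈ roots L ↔ A ∈ L ∧ ∀ B ∈ L, ¬ A < B := by
  simp [roots]

lemma mem_leaves {L : Finset (Biset V)} {A : Biset V} :
    A ∈ leaves L ↔ A ∈ L ∧ ∀ B ∈ L, ¬ B < A := by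
  simp only [leaves, Finset.mem_filter, and_congr_right_iff]
  refine fun _ => forall₂_congr fun B _ => ⟨fun h hlt => hlt.ne (h hlt.le), fun h hle => ?_⟩
  exact ((show B ≤ A from hle).eq_or_lt).resolve_right h

lemma leaves_subset {L : Finset (Biset V)} : leaves L ⊆ L := fun _ hA => (mem_leaves.1 hA).1

lemma exists_child_ge {L : Finset (Biset V)} {A B : Biset V} (hB : B ∈ L) (hBA : B < A) :
    ∃ R ∈ children L A, B ≤ R := by
  obtain ⟨R, hBR, hR⟩ := (L.filter (· < A)).exists_le_maximal (a := B) (by simp [hB, hBA])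
  have hR' := hR.prop
  simp only [Finset.mem_filter] at hR'
  refine ⟨R, mem_children.2 ⟨hR'.1, hR'.2, fun D hD hRD hDA => ?_⟩, hBR⟩
  exact hR.not_gt (by simp [hD, hDA]) hRD

lemma exists_parent {L : Finset (Biset V)} {R : Biset V} (hR : R ∈ L) (hroot : R ∉ roots L) :
    ∃ A ∈ L, R ∈ children L A := by
  obtain ⟨B, hB, hRB⟩ : ∃ B ∈ L, R < B := by
    by_contra! h
    exact hroot (mem_roots.2 ⟨hR, h⟩)
  obtain ⟨A, -, hA⟩ := (L.filter (R < ·)).exists_le_minimal (a := B) (by simp [hB, hRB])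
  have hA' := hA.prop
  simp only [Finset.mem_filter] at hA'
  refine ⟨A, hA'.1, mem_children.2 ⟨hR, hA'.2, fun D hD hRD hDA => ?_⟩⟩
  exact hA.not_lt (by simp [hD, hRD]) hDA

lemma children_eq_empty_iff {L : Finset (Biset V)} {A : Biset V} (hA : A ∈ L) :
    children L A = ∅ ↔ A ∈ leaves L := by
  refine ⟨fun h => mem_leaves.2 ⟨hA, fun B hB hBA => ?_⟩, fun h => ?_⟩
  · obtain ⟨R, hR, -⟩ := exists_child_ge hB hBA
    simp [h] at hR
  · refine Finset.eq_empty_of_forall_notMem fun R hR => ?_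
    have := mem_children.1 hR
    exact (mem_leaves.1 h).2 R this.1 this.2.1

variable [DecidableEq V]

lemma Laminar.le_or_le {L : Finset (Biset V)} (hL : Laminar L) {A B : Biset V} (hA : A ∈ L)
    (hB : B ∈ L) {v : V} (hvA : v ∈ A.inner) (hvB : v ∈ B.inner) : A ≤ B ∨ B ≤ A := by
  rcases hL A hA B hB with h | h | h
  · exact Or.inl h
  · exact Or.inr h
  · have : v ∈ A.inner ∩ B.inner := Finset.mem_inter.2 ⟨hvA, hvB⟩
    simp [h] at this

lemma Laminar.disjoint_of_antichain {L : Finset (Biset V)} (hL : Laminar L) {A B : Biset V}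
    (hA : A ∈ L) (hB : B ∈ L) (hAB : ¬ A ≤ B) (hBA : ¬ B ≤ A) :
    Disjoint A.inner B.inner := by
  rcases hL A hA B hB with h | h | h
  · exact absurd h hAB
  · exact absurd h hBA
  · exact Finset.disjoint_iff_inter_eq_empty.2 h

lemma Laminar.children_pairwise {L : Finset (Biset V)} (hL : Laminar L) (A : Biset V) :
    (children L A : Set (Biset V)).Pairwise fun R S => Disjoint R.inner S.inner := by
  intro R hR S hS hne
  obtain ⟨hR, hRA, hR'⟩ := mem_children.1 hR
  obtain ⟨hS, hSA, hS'⟩ := mem_children.1 hS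
  exact hL.disjoint_of_antichain hR hS (fun h => hR' S hS (h.lt_of_ne hne) hSA)
    (fun h => hS' R hR (h.lt_of_ne hne.symm) hRA)

lemma Laminar.roots_pairwise {L : Finset (Biset V)} (hL : Laminar L) :
    (roots L : Set (Biset V)).Pairwise fun R S => Disjoint R.inner S.inner := by
  intro R hR S hS hne
  obtain ⟨hR, hR'⟩ := mem_roots.1 hR
  obtain ⟨hS, hS'⟩ := mem_roots.1 hS
  exact hL.disjoint_of_antichain hR hS (fun h => hR' S hS (h.lt_of_ne hne))
    (fun h => hS' R hR (h.lt_of_ne hne.symm))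

/-- In a laminar family every non-maximal member is a child exactly once. -/
lemma Laminar.sum_sub_sum_children {L : Finset (Biset V)} (hL : Laminar L)
    (hne : ∀ A ∈ L, A.inner.Nonempty) (g : Biset V → ℤ) :
    ∑ A ∈ L, (g A - ∑ R ∈ children L A, g R) = ∑ R ∈ roots L, g R := by
  have hdisj : (L : Set (Biset V)).PairwiseDisjoint (children L) := by
    intro A hA B hB hAB
    refine Finset.disjoint_left.2 fun R hRA hRB => ?_
    obtain ⟨hR, hRA, hA'⟩ := mem_children.1 hRA
    obtain ⟨-, hRB, hB'⟩ := mem_children.1 hRB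
    obtain ⟨v, hv⟩ := hne R hR
    rcases hL.le_or_le hA hB (hRA.le.1 hv) (hRB.le.1 hv) with h | h
    · exact hB' A hA hRA (h.lt_of_ne hAB)
    · exact hA' B hB hRB (h.lt_of_ne hAB.symm)
  have hunion : L.biUnion (children L) = L \ roots L := by
    ext R
    simp only [Finset.mem_biUnion, Finset.mem_sdiff]
    constructor
    · rintro ⟨A, hA, hR⟩
      obtain ⟨hR, hRA, -⟩ := mem_children.1 hR
      exact ⟨hR, fun h => (mem_roots.1 h).2 A hA hRA⟩
    · rintro ⟨hR, hroot⟩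
      exact exists_parent hR hroot
  rw [Finset.sum_sub_distrib, ← Finset.sum_biUnion hdisj, hunion,
    ← Finset.sum_sdiff (show roots L ⊆ L from Finset.filter_subset _ _)]
  ring

lemma card_boundary_le_gammaL {L : Finset (Biset V)} {A : Biset V} (hA : A ∈ L) :
    A.boundary.card ≤ gammaL L :=
  Finset.le_sup (f := fun A : Biset V => (boundary A).card) hA

lemma card_outer_inter_le {L : Finset (Biset V)} {A : Biset V} (hA : A ∈ L) (C : Finset V) :
    (A.outer ∩ C).card ≤ (A.inner ∩ C).card + gammaL L := by
  have hsub : A.outer ∩ C ⊆ (A.inner ∩ C) ∪ A.boundary := by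
    intro v
    simp only [boundary, Finset.mem_inter, Finset.mem_union, Finset.mem_sdiff]
    tauto
  have := (Finset.card_le_card hsub).trans (Finset.card_union_le _ _)
  have := card_boundary_le_gammaL hA
  omega

/-- For members of `L` with disjoint inner parts inside `S`, the total size of the outer parts
exceeds the size of `S` by at most `γ` per member. -/
lemma sum_card_outer_inter_le {L K : Finset (Biset V)} (hK : K ⊆ L)
    (hdisj : (K : Set (Biset V)).Pairwise fun R S => Disjoint R.inner S.inner)
    {S : Finset V} (hS : ∀ R ∈ K, R.inner ⊆ S) (C : Finset V) :
    ∑ R ∈ K, (R.outer ∩ C).card ≤ (S ∩ C).card + K.card * gammaL L := by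
  have h1 : ∑ R ∈ K, (R.inner ∩ C).card ≤ (S ∩ C).card := by
    rw [← Finset.card_biUnion fun R hR T hT hne => (hdisj hR hT hne).mono
      Finset.inter_subset_left Finset.inter_subset_left]
    exact Finset.card_le_card (Finset.biUnion_subset.2 fun R hR =>
      Finset.inter_subset_inter (hS R hR) subset_rfl)
  calc ∑ R ∈ K, (R.outer ∩ C).card
      ≤ ∑ R ∈ K, ((R.inner ∩ C).card + gammaL L) :=
        Finset.sum_le_sum fun R hR => card_outer_inter_le (hK hR) C
    _ ≤ _ := by
        rw [Finset.sum_add_distrib, Finset.sum_const, smul_eq_mul]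
        omega

/-- If in a laminar family every marked non-leaf with exactly one child `R` has an outer part
meeting `C` outside the outer part of `R`, then the number of marked members is at most
`|C| + (2γ + 1) |leaves| - 1`. -/
lemma Laminar.card_marked_lt {L : Finset (Biset V)} (hL : Laminar L)
    (hne : ∀ A ∈ L, A.inner.Nonempty) {C : Finset V} (hC : C.Nonempty) (bad : Biset V → Prop)
    (hleaf : ∀ A ∈ leaves L, ¬ bad A)
    (hbad : ∀ A ∈ L, bad A → ∀ R, children L A = {R} → ∃ v ∈ C, v ∈ A.outer ∧ v ∉ R.outer) :
    ((L.filter bad).card : ℤ) + 1 ≤ C.card + (2 * gammaL L + 1) * (leaves L).card := by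
  set γ : ℤ := (gammaL L : ℤ) with hγ
  have hγ0 : 0 ≤ γ := by positivity
  let g : Biset V → ℤ := fun A => ((A.outer ∩ C).card : ℤ) - (2 * γ + 1)
  have hg : ∀ K : Finset (Biset V), ∑ R ∈ K, g R =
      ((∑ R ∈ K, (R.outer ∩ C).card : ℕ) : ℤ) - K.card * (2 * γ + 1) := by
    intro K
    simp [g, Finset.sum_sub_distrib]
  have hlocal : ∀ A ∈ L, (if bad A then (1 : ℤ) else 0) ≤
      (g A - ∑ R ∈ children L A, g R) + if A ∈ leaves L then 2 * γ + 1 else 0 := by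
    intro A hA
    have hchild : ∀ R ∈ children L A, R ≤ A := fun R hR => (mem_children.1 hR).2.1.le
    by_cases hlf : A ∈ leaves L
    · have h0 := (children_eq_empty_iff hA).2 hlf
      simp [hleaf A hlf, hlf, h0, g]
    · have hK : (children L A).Nonempty :=
        Finset.nonempty_iff_ne_empty.2 fun h => hlf ((children_eq_empty_iff hA).1 h)
      simp only [hlf, if_false, add_zero]
      rcases (Nat.one_le_iff_ne_zero.2 hK.card_pos.ne').eq_or_lt with h1 | h2
      · obtain ⟨R, hR⟩ := Finset.card_eq_one.1 h1.symm
        have hsub : R.outer ∩ C ⊆ A.outer ∩ C :=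
          Finset.inter_subset_inter (hchild R (by simp [hR])).2 subset_rfl
        simp only [hR, Finset.sum_singleton, g]
        split_ifs with hb
        · obtain ⟨v, hvC, hvA, hvR⟩ := hbad A hA hb R hR
          have : (R.outer ∩ C).card < (A.outer ∩ C).card :=
            Finset.card_lt_card ⟨hsub, fun h =>
              hvR (Finset.mem_inter.1 (h (Finset.mem_inter.2 ⟨hvA, hvC⟩))).1⟩
          omega
        · have := Finset.card_le_card hsub
          omega
      · have hsum := sum_card_outer_inter_le (L := L) (Finset.filter_subset _ _)
          (hL.children_pairwise A) (fun R hR => (hchild R hR).1) C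
        have hAo : (A.inner ∩ C).card ≤ (A.outer ∩ C).card :=
          Finset.card_le_card (Finset.inter_subset_inter A.subset subset_rfl)
        rw [hg]
        have hsum' : ((∑ R ∈ children L A, (R.outer ∩ C).card : ℕ) : ℤ) ≤
            (A.inner ∩ C).card + (children L A).card * γ := by rw [hγ]; exact_mod_cast hsum
        have h2' : (2 : ℤ) ≤ (children L A).card := by exact_mod_cast h2
        have : (if bad A then (1 : ℤ) else 0) ≤ 1 := by split_ifs <;> norm_num
        simp only [g]
        nlinarith [mul_nonneg (sub_nonneg.2 h2') hγ0]
  have htotal := Finset.sum_le_sum hlocal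
  rw [Finset.sum_add_distrib, hL.sum_sub_sum_children hne g, ← Finset.sum_filter,
    ← Finset.sum_filter, Finset.filter_mem_eq_inter,
    Finset.inter_eq_right.2 leaves_subset] at htotal
  simp only [Finset.sum_const, nsmul_eq_mul, mul_one] at htotal
  have hroots : ∑ R ∈ roots L, g R ≤ C.card - 1 := by
    have hsum := sum_card_outer_inter_le (K := roots L) (Finset.filter_subset _ _)
      hL.roots_pairwise (S := (roots L).biUnion inner)
      (fun R hR => Finset.subset_biUnion_of_mem inner hR) C
    have hCc := Finset.card_le_card
      (Finset.inter_subset_right (s₁ := (roots L).biUnion inner) (s₂ := C))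
    have hsum' : ((∑ R ∈ roots L, (R.outer ∩ C).card : ℕ) : ℤ) ≤
        C.card + (roots L).card * γ := by rw [hγ]; exact_mod_cast hsum.trans (by gcongr)
    rcases (roots L).eq_empty_or_nonempty with h0 | hr
    · have := hC.card_pos
      simp only [h0, Finset.sum_empty]
      omega
    · have hr1 : (1 : ℤ) ≤ (roots L).card := by exact_mod_cast hr.card_pos
      rw [hg]
      nlinarith [mul_nonneg (sub_nonneg.2 hr1) hγ0]
  linarith

end Biset

section Tokens

open Biset

variable {V E : Type*} [DecidableEq V] [Fintype E]

lemma mem_inDelta {tail head : E → V} {A : Biset V} {e : E} :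
    e ∈ inDelta tail head A ↔ head e ∈ A.inner ∧ tail e ∉ A.outer := by
  simp [inDelta]

lemma mem_outDeg {tail head : E → V} {v : V} {e : E} :
    e ∈ outDeg tail head v ↔ tail e = v ∧ head e ≠ v := by
  simp [outDeg, outDelta, vertexBiset]

/-- Edges entering `A` that enter no child of `A`. -/
def newEdges (tail head : E → V) (L : Finset (Biset V)) (A : Biset V) : Finset E :=
  inDelta tail head A \ (children L A).biUnion (inDelta tail head)

/-- Edges entering some child of `A` but not `A` itself. -/
def lostEdges (tail head : E → V) (L : Finset (Biset V)) (A : Biset V) : Finset E :=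
  (children L A).biUnion (inDelta tail head) \ inDelta tail head A

variable {tail head : E → V} {L : Finset (Biset V)}

lemma mem_newEdges {A : Biset V} {e : E} : e ∈ newEdges tail head L A ↔
    e ∈ inDelta tail head A ∧ ∀ R ∈ children L A, e ∉ inDelta tail head R := by
  simp [newEdges]

lemma mem_lostEdges {A : Biset V} {e : E} : e ∈ lostEdges tail head L A ↔
    (∃ R ∈ children L A, e ∈ inDelta tail head R) ∧ e ∉ inDelta tail head A := by
  simp [lostEdges]

/-- An edge lost at `A` has its tail in the outer part of `A`. -/
lemma tail_mem_outer_of_mem_lostEdges {A : Biset V} {e : E}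
    (he : e ∈ lostEdges tail head L A) : tail e ∈ A.outer := by
  obtain ⟨⟨R, hR, heR⟩, heA⟩ := mem_lostEdges.1 he
  by_contra h
  exact heA (mem_inDelta.2 ⟨(mem_children.1 hR).2.1.le.1 (mem_inDelta.1 heR).1, h⟩)

lemma pairwiseDisjoint_newEdges (hL : Laminar L) :
    (L : Set (Biset V)).PairwiseDisjoint (newEdges tail head L) := by
  have key : ∀ A ∈ L, ∀ B ∈ L, A < B → ∀ e, e ∈ newEdges tail head L A →
      e ∉ newEdges tail head L B := by
    intro A hA B hB hAB e heA heB
    obtain ⟨R, hR, hAR⟩ := exists_child_ge hA hAB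
    have heA' := mem_inDelta.1 (mem_newEdges.1 heA).1
    obtain ⟨heB', hB'⟩ := mem_newEdges.1 heB
    exact hB' R hR (mem_inDelta.2 ⟨hAR.1 heA'.1,
      fun h => (mem_inDelta.1 heB').2 ((mem_children.1 hR).2.1.le.2 h)⟩)
  intro A hA B hB hne
  refine Finset.disjoint_left.2 fun e heA heB => ?_
  rcases hL.le_or_le hA hB (mem_inDelta.1 (mem_newEdges.1 heA).1).1
    (mem_inDelta.1 (mem_newEdges.1 heB).1).1 with h | h
  · exact key A hA B hB (h.lt_of_ne hne) e heA heB
  · exact key B hB A hA (h.lt_of_ne hne.symm) e heB heA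

lemma pairwiseDisjoint_lostEdges (hL : Laminar L) :
    (L : Set (Biset V)).PairwiseDisjoint (lostEdges tail head L) := by
  have hhead : ∀ A e, e ∈ lostEdges tail head L A → head e ∈ A.inner := by
    intro A e he
    obtain ⟨⟨R, hR, heR⟩, -⟩ := mem_lostEdges.1 he
    exact (mem_children.1 hR).2.1.le.1 (mem_inDelta.1 heR).1
  have key : ∀ A ∈ L, ∀ B ∈ L, A < B → ∀ e, e ∈ lostEdges tail head L A →
      e ∉ lostEdges tail head L B := by
    intro A hA B hB hAB e heA heB
    obtain ⟨⟨R, hR, heR⟩, -⟩ := mem_lostEdges.1 heB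
    obtain ⟨hRL, -, hR'⟩ := mem_children.1 hR
    have hAR : A ≤ R := by
      rcases hL.le_or_le hA hRL (hhead A e heA) (mem_inDelta.1 heR).1 with h | h
      · exact h
      · rcases h.eq_or_lt with h | h
        · exact h.ge
        · exact absurd hAB (hR' A hA h)
    exact (mem_inDelta.1 heR).2 (hAR.2 (tail_mem_outer_of_mem_lostEdges heA))
  intro A hA B hB hne
  refine Finset.disjoint_left.2 fun e heA heB => ?_
  rcases hL.le_or_le hA hB (hhead A e heA) (hhead B e heB) with h | h
  · exact key A hA B hB (h.lt_of_ne hne) e heA heB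
  · exact key B hB A hA (h.lt_of_ne hne.symm) e heB heA

lemma sum_biUnion_inDelta_children (hL : Laminar L) (A : Biset V) (x : E → ℝ) :
    ∑ e ∈ (children L A).biUnion (inDelta tail head), x e =
      ∑ R ∈ children L A, ∑ e ∈ inDelta tail head R, x e := by
  refine Finset.sum_biUnion fun R hR S hS hne => Finset.disjoint_left.2 fun e heR heS => ?_
  exact Finset.disjoint_left.1 (hL.children_pairwise A hR hS hne)
    (mem_inDelta.1 heR).1 (mem_inDelta.1 heS).1

lemma sum_newEdges_sub_sum_lostEdges (hL : Laminar L) (A : Biset V) (x : E → ℝ) :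
    ∑ e ∈ newEdges tail head L A, x e - ∑ e ∈ lostEdges tail head L A, x e =
      ∑ e ∈ inDelta tail head A, x e - ∑ R ∈ children L A, ∑ e ∈ inDelta tail head R, x e := by
  rw [← sum_biUnion_inDelta_children hL]
  exact Finset.sum_sdiff_sub_sum_sdiff

/-- Linear independence forces every member of `L` to differ from the union of its children. -/
lemma newEdges_or_lostEdges_nonempty (hL : Laminar L)
    (hind : LinearIndependent ℝ fun A : {A // A ∈ L} => incVec (inDelta tail head A.1))
    {A : Biset V} (hA : A ∈ L) :
    (newEdges tail head L A).Nonempty ∨ (lostEdges tail head L A).Nonempty := by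
  by_contra! h
  have heq : inDelta tail head A = (children L A).biUnion (inDelta tail head) :=
    Finset.Subset.antisymm (Finset.sdiff_eq_empty_iff_subset.1 h.1)
      (Finset.sdiff_eq_empty_iff_subset.1 h.2)
  refine hind.notMem_span_image (s := {R | R.1 ∈ children L A}) (x := ⟨A, hA⟩)
    (fun h => (mem_children.1 h).2.1.ne rfl) ?_
  have hsum : incVec (inDelta tail head A) =
      ∑ R ∈ children L A, incVec (inDelta tail head R) := by
    ext e
    have := sum_biUnion_inDelta_children (tail := tail) (head := head) hL A
      (fun e' => if e' = e then 1 else 0)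
    simp only [Finset.sum_ite_eq', ← heq] at this
    simpa [incVec] using this
  simp only [hsum]
  refine Submodule.sum_mem _ fun R hR => Submodule.subset_span ?_
  exact ⟨⟨R, (mem_children.1 hR).1⟩, hR, rfl⟩

/-- The amount collected by `A` when every edge `e` gives `α * x e` to the member of `L` at which
it is new and, if its tail is not in `C`, gives `1 - α * x e` to the member at which it is lost. -/
def tokens (tail head : E → V) (L : Finset (Biset V)) (C : Finset V) (α : ℝ) (x : E → ℝ)
    (A : Biset V) : ℝ :=
  ∑ e ∈ newEdges tail head L A, α * x e +
    ∑ e ∈ (lostEdges tail head L A).filter (tail · ∉ C), (1 - α * x e)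

variable {C : Finset V} {x : E → ℝ}

lemma tokens_nonneg {α : ℝ} (h0 : ∀ e, 0 < α * x e) (h1 : ∀ e, α * x e < 1) (A : Biset V) :
    0 ≤ tokens tail head L C α x A :=
  add_nonneg (Finset.sum_nonneg fun e _ => (h0 e).le)
    (Finset.sum_nonneg fun e _ => sub_nonneg.2 (h1 e).le)

lemma le_tokens_of_mem_leaves {α : ℝ} (h0 : 0 ≤ α) (h1 : ∀ e, α * x e < 1) {A : Biset V}
    (hA : A ∈ leaves L) (hx : 1 ≤ ∑ e ∈ inDelta tail head A, x e) :
    α ≤ tokens tail head L C α x A := by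
  have hK := (children_eq_empty_iff (mem_leaves.1 hA).1).2 hA
  have hlost : 0 ≤ ∑ e ∈ (lostEdges tail head L A).filter (tail · ∉ C), (1 - α * x e) :=
    Finset.sum_nonneg fun e _ => sub_nonneg.2 (h1 e).le
  rw [tokens, ← Finset.mul_sum]
  simp only [newEdges, hK, Finset.biUnion_empty, Finset.sdiff_empty]
  nlinarith

/-- The tokens of a member none of whose lost edges leaves `C` form a positive integer. -/
lemma one_le_tokens {α : ℤ} (hL : Laminar L) (h0 : ∀ e, 0 < α * x e) (h1 : ∀ e, α * x e < 1)
    {f : Biset V → ℤ} (hf : ∀ A ∈ L, ∑ e ∈ inDelta tail head A, x e = f A)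
    (hind : LinearIndependent ℝ fun A : {A // A ∈ L} => incVec (inDelta tail head A.1))
    {A : Biset V} (hA : A ∈ L) (hC : ∀ e ∈ lostEdges tail head L A, tail e ∉ C) :
    1 ≤ tokens tail head L C α x A := by
  have heq : tokens tail head L C α x A = ∑ e ∈ newEdges tail head L A, α * x e +
      ∑ e ∈ lostEdges tail head L A, (1 - α * x e) := by
    rw [tokens, Finset.filter_true_of_mem hC]
  have hint : tokens tail head L C α x A =
      ((α * (f A - ∑ R ∈ children L A, f R) + (lostEdges tail head L A).card : ℤ) : ℝ) := by
    have h := sum_newEdges_sub_sum_lostEdges (tail := tail) (head := head) hL A x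
    rw [hf A hA, Finset.sum_congr rfl fun R hR => hf R (mem_children.1 hR).1] at h
    push_cast
    rw [heq, ← h, Finset.sum_sub_distrib, ← Finset.mul_sum, ← Finset.mul_sum]
    simp
    ring
  have hpos : 0 < tokens tail head L C α x A := by
    rw [heq]
    rcases newEdges_or_lostEdges_nonempty hL hind hA with h | h
    · exact add_pos_of_pos_of_nonneg (Finset.sum_pos (fun e _ => h0 e) h)
        (Finset.sum_nonneg fun e _ => sub_nonneg.2 (h1 e).le)
    · exact add_pos_of_nonneg_of_pos (Finset.sum_nonneg fun e _ => (h0 e).le)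
        (Finset.sum_pos (fun e _ => sub_pos.2 (h1 e)) h)
  rw [hint] at hpos ⊢
  exact_mod_cast Int.cast_pos.1 hpos

/-- No edge gives away more than one unit. -/
lemma sum_tokens_add_le {α : ℝ} (hL : Laminar L) (h0 : ∀ e, 0 < α * x e)
    (h1 : ∀ e, α * x e < 1) :
    ∑ A ∈ L, tokens tail head L C α x A + ∑ v ∈ C, ∑ e ∈ outDeg tail head v, (1 - α * x e) ≤
      Fintype.card E := by
  have hnew : ∑ A ∈ L, ∑ e ∈ newEdges tail head L A, α * x e ≤ ∑ e, α * x e := by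
    rw [← Finset.sum_biUnion (pairwiseDisjoint_newEdges hL)]
    exact Finset.sum_le_univ_sum_of_nonneg fun e => (h0 e).le
  have hlost : ∑ A ∈ L, ∑ e ∈ (lostEdges tail head L A).filter (tail · ∉ C), (1 - α * x e) ≤
      ∑ e with tail e ∉ C, (1 - α * x e) := by
    rw [← Finset.sum_biUnion fun A hA B hB hne => (pairwiseDisjoint_lostEdges hL hA hB hne).mono
      (Finset.filter_subset _ _) (Finset.filter_subset _ _)]
    refine Finset.sum_le_sum_of_subset_of_nonneg (fun e he => ?_)
      fun e _ _ => sub_nonneg.2 (h1 e).le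
    simp only [Finset.mem_biUnion, Finset.mem_filter] at he
    obtain ⟨A, -, -, he⟩ := he
    simpa using he
  have hout : ∑ v ∈ C, ∑ e ∈ outDeg tail head v, (1 - α * x e) ≤
      ∑ e with tail e ∈ C, (1 - α * x e) := by
    have hdisj : (C : Set V).PairwiseDisjoint (outDeg tail head) := fun v _ w _ hne =>
      Finset.disjoint_left.2 fun e hv hw =>
        hne ((mem_outDeg.1 hv).1.symm.trans (mem_outDeg.1 hw).1)
    rw [← Finset.sum_biUnion hdisj]
    refine Finset.sum_le_sum_of_subset_of_nonneg (fun e he => ?_)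
      fun e _ _ => sub_nonneg.2 (h1 e).le
    obtain ⟨v, hv, he⟩ := Finset.mem_biUnion.1 he
    simpa [(mem_outDeg.1 he).1] using hv
  have hsplit := Finset.sum_filter_add_sum_filter_not Finset.univ (tail · ∈ C)
    (fun e => 1 - α * x e)
  have htot : ∑ e, (1 - α * x e) = Fintype.card E - ∑ e, α * x e := by
    simp [Finset.sum_sub_distrib]
  simp only [tokens, Finset.sum_add_distrib]
  linarith

end Tokens

theorem stmt_8 {V E : Type*} [Fintype V] [DecidableEq V] [Fintype E] [Nonempty E]
    (tail head : E → V) (B : Finset V) (b : V → ℕ)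
    (f : Biset V → ℤ) (α : ℤ) (hα : 2 ≤ α)
    (x : E → ℝ) (hx : x ∈ dirP tail head f B b)
    (hx01 : ∀ e : E, 0 < x e ∧ x e < 1)
    (L : Finset (Biset V)) (C : Finset V)
    (hlam : Biset.Laminar L) (hCB : C ⊆ B)
    (hcard : L.card + C.card = Fintype.card E)
    (htight : ∀ A ∈ L, (∑ e ∈ inDelta tail head A, x e) = (f A : ℝ) ∧ 1 ≤ f A)
    (hdeg : ∀ v ∈ C, (∑ e ∈ outDeg tail head v, x e) = (b v : ℝ))
    (hind : LinearIndependent ℝ (Sum.elim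
      (fun A : {A // A ∈ L} => incVec (inDelta tail head A.1))
      (fun v : {v // v ∈ C} => incVec (outDeg tail head v.1))))
    (hEC : (α - 1) * ((leaves L).card : ℤ) < (C.card : ℤ)) :
    (∃ e : E, 1 / (α : ℝ) ≤ x e) ∨
    (∃ v ∈ C, ((outDeg tail head v).card : ℤ) ≤
      α * (b v : ℤ) + ⌈(2 * (gammaL L : ℝ)) / ((α : ℝ) - 1)⌉ + 1) := by
  by_contra! hcon
  obtain ⟨hsmall, hbig⟩ := hcon
  have hα0 : (0 : ℝ) < α := by exact_mod_cast (by omega : 0 < α)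
  have h0 : ∀ e, 0 < α * x e := fun e => mul_pos hα0 (hx01 e).1
  have h1 : ∀ e, α * x e < 1 := fun e => by
    have := (lt_div_iff₀ hα0).1 (hsmall e)
    linarith
  have hne : ∀ A ∈ L, A.inner.Nonempty := by
    intro A hA
    by_contra hemp
    have hzero : inDelta tail head A = ∅ := by
      simp [inDelta, Finset.not_nonempty_iff_eq_empty.1 hemp]
    have hA' := htight A hA
    rw [hzero, Finset.sum_empty] at hA'
    have : f A = 0 := by exact_mod_cast hA'.1.symm
    omega
  have hCne : C.Nonempty := by
    refine Finset.card_pos.1 ?_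
    have : 0 ≤ (α - 1) * ((leaves L).card : ℤ) := mul_nonneg (by omega) (by omega)
    omega
  have hindL : LinearIndependent ℝ fun A : {A // A ∈ L} => incVec (inDelta tail head A.1) :=
    hind.comp Sum.inl Sum.inl_injective
  obtain ⟨bad, hbad⟩ : ∃ bad : Biset V → Prop,
      ∀ A, bad A ↔ ∃ e ∈ lostEdges tail head L A, tail e ∈ C := ⟨_, fun _ => Iff.rfl⟩
  have hleaf : ∀ A ∈ leaves L, ¬ bad A := by
    intro A hA hb
    obtain ⟨e, he, -⟩ := (hbad A).1 hb
    obtain ⟨⟨R, hR, -⟩, -⟩ := mem_lostEdges.1 he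
    rw [(Biset.children_eq_empty_iff (Biset.mem_leaves.1 hA).1).2 hA] at hR
    simp at hR
  have hN := hlam.card_marked_lt hne hCne bad hleaf (by
    intro A hA hb R hR
    obtain ⟨e, he, heC⟩ := (hbad A).1 hb
    refine ⟨tail e, heC, tail_mem_outer_of_mem_lostEdges he, ?_⟩
    obtain ⟨⟨S, hS, heS⟩, -⟩ := mem_lostEdges.1 he
    rw [hR, Finset.mem_singleton] at hS
    exact hS ▸ (mem_inDelta.1 heS).2)
  set q : ℤ := ⌈(2 * (gammaL L : ℝ)) / ((α : ℝ) - 1)⌉ with hq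
  have hq' : 2 * (gammaL L : ℤ) ≤ q * (α - 1) := by
    have h := Int.le_ceil ((2 * (gammaL L : ℝ)) / ((α : ℝ) - 1))
    have hα1 : (0 : ℝ) < α - 1 := by
      have : (2 : ℝ) ≤ α := by exact_mod_cast hα
      linarith
    rw [div_le_iff₀ hα1, ← hq] at h
    exact_mod_cast h
  have hq0 : 0 ≤ q := by
    by_contra! h
    nlinarith
  have hout : (C.card : ℝ) * (q + 2) ≤
      ∑ v ∈ C, ∑ e ∈ outDeg tail head v, (1 - α * x e) := by
    rw [← nsmul_eq_mul]
    refine Finset.card_nsmul_le_sum _ _ _ fun v hv => ?_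
    have h : α * (b v : ℤ) + q + 2 ≤ (outDeg tail head v).card := by
      have := hbig v hv
      omega
    have h' : (α : ℝ) * b v + q + 2 ≤ (outDeg tail head v).card := by exact_mod_cast h
    rw [Finset.sum_sub_distrib, ← Finset.mul_sum, hdeg v hv]
    simp
    linarith
  have hlower : ∀ A ∈ L, 1 + (if A ∈ leaves L then (α : ℝ) - 1 else 0) - (if bad A then 1 else 0)
      ≤ tokens tail head L C α x A := by
    intro A hA
    by_cases hlf : A ∈ leaves L
    · have := le_tokens_of_mem_leaves (tail := tail) (head := head) (C := C) hα0.le h1 hlf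
        (by rw [(htight A hA).1]; exact_mod_cast (htight A hA).2)
      simp [hlf, hleaf A hlf, this]
    · by_cases hb : bad A
      · simpa [hlf, hb] using tokens_nonneg h0 h1 A
      · simpa [hlf, hb] using one_le_tokens hlam h0 h1 (fun A hA => (htight A hA).1) hindL hA
          fun e he heC => hb ((hbad A).2 ⟨e, he, heC⟩)
  have hsum := Finset.sum_le_sum hlower
  rw [Finset.sum_sub_distrib, Finset.sum_add_distrib, ← Finset.sum_filter, ← Finset.sum_filter,
    Finset.filter_mem_eq_inter,
    Finset.inter_eq_right.2 Biset.leaves_subset] at hsum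
  simp only [Finset.sum_const, nsmul_eq_mul, mul_one] at hsum
  have htotal := sum_tokens_add_le (tail := tail) (head := head) (C := C) hlam h0 h1
  rw [← hcard] at htotal
  push_cast at htotal
  have hfinal : (L.card : ℤ) + (leaves L).card * (α - 1) - (L.filter bad).card +
      C.card * (q + 2) ≤ L.card + C.card := by
    have : (L.card : ℝ) + (leaves L).card * (α - 1) - (L.filter bad).card +
      C.card * (q + 2) ≤ L.card + C.card := by linarith
    exact_mod_cast this
  have hqC := mul_le_mul_of_nonneg_right hEC.le hq0
  have hqℓ := mul_le_mul_of_nonneg_right hq' (Nat.cast_nonneg (α := ℤ) (leaves L).card)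
  have hαℓ := mul_nonneg (sub_nonneg.2 hα) (Nat.cast_nonneg (α := ℤ) (leaves L).card)
  linarith
end
end
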